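/- arXiv:1812.08461 — 2 statements merged into one kernel-verified Lean document; each statement's English description precedes it below -/
import Mathlib

section
/- Coordinate formula for the polarized Poisson bracket: for smooth a, b, a', b', writing H = H_{a,b} and K = H_{a',b'}, for every m ∈ E and p ∈ Fin k, −θ_p(X_{a,b}(m), X_{a',b'}(m)) = Σ_i ( ∂H^p/∂y_i(m) · ∂K^p/∂x_{p i}(m) − ∂H^p/∂x_{p i}(m) · ∂K^p/∂y_i(m) ), where ∂/∂x_{p i} and ∂/∂y_i denote the derivative (fderiv) at m in the direction of the corresponding standard basis vectors of E and H^p(m) = H(m) p. -/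
noncomputable section

/-- The model polarized k-symplectic space `E = (ℝ^n)^k × ℝ^n`. -/
abbrev E (k n : ℕ) : Type := (Fin k → Fin n → ℝ) × (Fin n → ℝ)

/-- The components `θ_p` of the canonical polarized k-symplectic form:
`θ_p((x,y),(x',y')) = Σ_i (x p i * y' i − x' p i * y i)`. -/
def theta (k n : ℕ) (p : Fin k) (w v : E k n) : ℝ :=
  ∑ i, (w.1 p i * v.2 i - v.1 p i * w.2 i)

/-- The polarized Hamiltonian `H_{a,b}(x,y) p = Σ_j a j (y) * x p j + b p (y)`. -/
def Ham {k n : ℕ} (a : (Fin n → ℝ) → (Fin n → ℝ)) (b : (Fin n → ℝ) → (Fin k → ℝ))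
    (m : E k n) : Fin k → ℝ :=
  fun p => ∑ j, a m.2 j * m.1 p j + b m.2 p

/-- The polarized Hamiltonian vector field `X_{a,b}`, with first component
`(p,s) ↦ −(Σ_j x p j * ∂a_j/∂y_s(y) + ∂b_p/∂y_s(y))` and second component `i ↦ a i (y)`. -/
def HamVF {k n : ℕ} (a : (Fin n → ℝ) → (Fin n → ℝ)) (b : (Fin n → ℝ) → (Fin k → ℝ))
    (m : E k n) : E k n :=
  (fun p s => -((∑ j, m.1 p j * fderiv ℝ a m.2 (Pi.single s 1) j)
      + fderiv ℝ b m.2 (Pi.single s 1) p),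
   fun i => a m.2 i)

/-- The Lie bracket of vector fields `[X,Y](m) = (fderiv ℝ Y m)(X m) − (fderiv ℝ X m)(Y m)`. -/
def lieBracketVF {k n : ℕ} (X Y : E k n → E k n) (m : E k n) : E k n :=
  fderiv ℝ Y m (X m) - fderiv ℝ X m (Y m)

/-- The derivative of a component of the polarized Hamiltonian in an arbitrary direction. -/
lemma fderiv_Ham_apply {k n : ℕ} {a : (Fin n → ℝ) → (Fin n → ℝ)}
    {b : (Fin n → ℝ) → (Fin k → ℝ)} {m : E k n} (ha : DifferentiableAt ℝ a m.2)
    (hb : DifferentiableAt ℝ b m.2) (p : Fin k) (v : E k n) :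
    fderiv ℝ (fun m => Ham a b m p) m v
      = ∑ j, (a m.2 j * v.1 p j + m.1 p j * fderiv ℝ a m.2 v.2 j) + fderiv ℝ b m.2 v.2 p := by
  have hy : HasFDerivAt (fun q : E k n => q.2) (ContinuousLinearMap.snd ℝ _ _) m :=
    hasFDerivAt_snd
  have hx : ∀ j, HasFDerivAt (fun q : E k n => q.1 p j)
      ((ContinuousLinearMap.proj (R := ℝ) (φ := fun _ : Fin n => ℝ) j).comp
        ((ContinuousLinearMap.proj (R := ℝ) (φ := fun _ : Fin k => Fin n → ℝ) p).comp
          (ContinuousLinearMap.fst ℝ _ _))) m :=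
    fun j => hasFDerivAt_pi'.1 (hasFDerivAt_pi'.1 hasFDerivAt_fst p) j
  have hay := hasFDerivAt_pi'.1 (ha.hasFDerivAt.comp m hy)
  have hby := hasFDerivAt_pi'.1 (hb.hasFDerivAt.comp m hy)
  have h : HasFDerivAt (fun q : E k n => Ham a b q p) _ m :=
    (HasFDerivAt.fun_sum (u := Finset.univ) fun j _ => (hay j).mul (hx j)).add (hby p)
  rw [h.fderiv]
  simp

/-- coordinate formula for the polarized Poisson bracket. -/
theorem poisson_coordinate_formula (k n : ℕ) (hk : 1 ≤ k) (hn : 1 ≤ n)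
    (a a' : (Fin n → ℝ) → (Fin n → ℝ)) (b b' : (Fin n → ℝ) → (Fin k → ℝ))
    (ha : ContDiff ℝ (⊤ : ℕ∞) a) (hb : ContDiff ℝ (⊤ : ℕ∞) b)
    (ha' : ContDiff ℝ (⊤ : ℕ∞) a') (hb' : ContDiff ℝ (⊤ : ℕ∞) b') :
    ∀ (m : E k n) (p : Fin k),
      -theta k n p (HamVF a b m) (HamVF a' b' m)
        = ∑ i,
            (fderiv ℝ (fun m => Ham a b m p) m ((0, Pi.single i 1) : E k n)
              * fderiv ℝ (fun m => Ham a' b' m p) m ((Pi.single p (Pi.single i 1), 0) : E k n)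
            - fderiv ℝ (fun m => Ham a b m p) m ((Pi.single p (Pi.single i 1), 0) : E k n)
              * fderiv ℝ (fun m => Ham a' b' m p) m ((0, Pi.single i 1) : E k n)) := by
  intro m p
  have da := (ha.differentiable (by simp)).differentiableAt (x := m.2)
  have db := (hb.differentiable (by simp)).differentiableAt (x := m.2)
  have da' := (ha'.differentiable (by simp)).differentiableAt (x := m.2)
  have db' := (hb'.differentiable (by simp)).differentiableAt (x := m.2)
  simp only [fderiv_Ham_apply da db, fderiv_Ham_apply da' db', theta, HamVF,
    ← Finset.sum_neg_distrib]
  refine Finset.sum_congr rfl fun i _ => ?_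
  simp [Pi.single_apply]
  ring
end
end

section
/- The Lie bracket of two polarized Hamiltonian vector fields is again a polarized Hamiltonian vector field, with explicit coefficients: for smooth a, b, a', b', the Lie bracket [X_{a,b}, X_{a',b'}] equals X_{a'',b''}, where a'' j (y) = Σ_i ( a i (y) · ∂a'_j/∂y_i(y) − a' i (y) · ∂a_j/∂y_i(y) ) and b'' p (y) = Σ_i ( a i (y) · ∂b'_p/∂y_i(y) − a' i (y) · ∂b_p/∂y_i(y) ). -/
noncomputable section

/-- A continuous linear map on `ℝ^n`, expanded in the standard basis. -/
theorem sum_mul_apply_single {n m : ℕ} (L : (Fin n → ℝ) →L[ℝ] (Fin m → ℝ)) (v : Fin n → ℝ)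
    (j : Fin m) : ∑ i, v i * L (Pi.single i 1) j = L v j := by
  conv_rhs => rw [pi_eq_sum_univ' v, map_sum]
  simp [Finset.sum_apply]

/-- The derivative of `y ↦ Df(y)(g(y))`. -/
theorem hasFDerivAt_fderiv_apply {V W : Type*} [NormedAddCommGroup V] [NormedSpace ℝ V]
    [NormedAddCommGroup W] [NormedSpace ℝ W] {f : V → W} {g : V → V}
    (hf : ContDiff ℝ (⊤ : ℕ∞) f) (hg : ContDiff ℝ (⊤ : ℕ∞) g) (y : V) :
    HasFDerivAt (fun z => fderiv ℝ f z (g z))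
      ((fderiv ℝ f y).comp (fderiv ℝ g y) + (fderiv ℝ (fderiv ℝ f) y).flip (g y)) y :=
  ((hf.fderiv_right (m := (⊤ : ℕ∞)) (by simp)).differentiable (by simp) y).hasFDerivAt.clm_apply
    (hg.differentiable (by simp) y).hasFDerivAt

/-- The second derivative of a smooth map is symmetric. -/
theorem fderiv_fderiv_comm {V W : Type*} [NormedAddCommGroup V] [NormedSpace ℝ V]
    [NormedAddCommGroup W] [NormedSpace ℝ W] {f : V → W}
    (hf : ContDiff ℝ (⊤ : ℕ∞) f) (y v w : V) :
    fderiv ℝ (fderiv ℝ f) y v w = fderiv ℝ (fderiv ℝ f) y w v :=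
  (hf.contDiffAt.isSymmSndFDerivAt (by simpa using WithTop.coe_le_coe.2 (le_top (a := (2 : ℕ∞))))) v w

/-- The derivative of a vector field of the form `y ↦ Df'(y)(a(y)) - Df(y)(a'(y))`. -/
theorem fderiv_fderiv_apply_sub {V W : Type*} [NormedAddCommGroup V] [NormedSpace ℝ V]
    [NormedAddCommGroup W] [NormedSpace ℝ W] {f f' : V → W} {a a' : V → V}
    (hf : ContDiff ℝ (⊤ : ℕ∞) f) (hf' : ContDiff ℝ (⊤ : ℕ∞) f')
    (ha : ContDiff ℝ (⊤ : ℕ∞) a) (ha' : ContDiff ℝ (⊤ : ℕ∞) a') (y v : V) :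
    fderiv ℝ (fun z => fderiv ℝ f' z (a z) - fderiv ℝ f z (a' z)) y v
      = (fderiv ℝ f' y (fderiv ℝ a y v) + fderiv ℝ (fderiv ℝ f') y (a y) v)
        - (fderiv ℝ f y (fderiv ℝ a' y v) + fderiv ℝ (fderiv ℝ f) y (a' y) v) := by
  rw [((hasFDerivAt_fderiv_apply hf' ha y).fun_sub (hasFDerivAt_fderiv_apply hf ha' y)).fderiv,
    fderiv_fderiv_comm hf', fderiv_fderiv_comm hf]
  simp

/-- The derivative of a polarized Hamiltonian vector field. -/
theorem fderiv_hamVF {k n : ℕ} {a : (Fin n → ℝ) → (Fin n → ℝ)} {b : (Fin n → ℝ) → (Fin k → ℝ)}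
    (ha : ContDiff ℝ (⊤ : ℕ∞) a) (hb : ContDiff ℝ (⊤ : ℕ∞) b) (m v : E k n) :
    fderiv ℝ (HamVF a b) m v
      = (fun p s => -((∑ j, (m.1 p j * fderiv ℝ (fderiv ℝ a) m.2 v.2 (Pi.single s 1) j
            + v.1 p j * fderiv ℝ a m.2 (Pi.single s 1) j))
          + fderiv ℝ (fderiv ℝ b) m.2 v.2 (Pi.single s 1) p),
        fderiv ℝ a m.2 v.2) := by
  have hsnd : HasFDerivAt (fun m : E k n => m.2) (ContinuousLinearMap.snd ℝ _ _) m :=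
    hasFDerivAt_snd
  have hfst (p : Fin k) (j : Fin n) : HasFDerivAt (fun m : E k n => m.1 p j)
      (((ContinuousLinearMap.proj j).comp (ContinuousLinearMap.proj p)).comp
        (ContinuousLinearMap.fst ℝ (Fin k → Fin n → ℝ) (Fin n → ℝ))) m :=
    (((ContinuousLinearMap.proj j).comp (ContinuousLinearMap.proj p)).comp
      (ContinuousLinearMap.fst ℝ (Fin k → Fin n → ℝ) (Fin n → ℝ))).hasFDerivAt
  have hpartial {d : ℕ} {f : (Fin n → ℝ) → (Fin d → ℝ)} (hf : ContDiff ℝ (⊤ : ℕ∞) f)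
      (s : Fin n) (j : Fin d) :=
    (hasFDerivAt_pi'.1 (hasFDerivAt_fderiv_apply hf
      (contDiff_const (c := (Pi.single s 1 : Fin n → ℝ))) m.2) j).comp m hsnd
  have hX := (hasFDerivAt_pi.2 fun p => hasFDerivAt_pi.2 fun s =>
    ((HasFDerivAt.fun_sum (u := Finset.univ) fun j _ =>
      (hfst p j).mul (hpartial ha s j)).add (hpartial hb s p)).neg).prodMk
    ((ha.differentiable (by simp) m.2).hasFDerivAt.comp m hsnd)
  have hX' : HasFDerivAt (HamVF a b) _ m := hX
  rw [hX'.fderiv]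
  ext <;> simp [mul_comm]

/-- Contracting the first component of `X_{a,b}` with a vector. -/
theorem sum_hamVF_fst_mul {k n : ℕ} (a : (Fin n → ℝ) → (Fin n → ℝ))
    (b : (Fin n → ℝ) → (Fin k → ℝ)) (m : E k n) (p : Fin k) (w : Fin n → ℝ) :
    ∑ j, (HamVF a b m).1 p j * w j
      = -((∑ j, m.1 p j * fderiv ℝ a m.2 w j) + fderiv ℝ b m.2 w p) := by
  simp only [HamVF, ← sum_mul_apply_single _ w, Finset.mul_sum, neg_mul, add_mul, Finset.sum_mul,
    Finset.sum_neg_distrib, Finset.sum_add_distrib]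
  rw [Finset.sum_comm]
  congr 2
  · exact Finset.sum_congr rfl fun _ _ => Finset.sum_congr rfl fun _ _ => by ring
  · exact Finset.sum_congr rfl fun _ _ => mul_comm _ _


/-- the Lie bracket of two polarized Hamiltonian vector fields is again a
polarized Hamiltonian vector field, with explicit coefficients. -/
theorem lieBracket_hamVF (k n : ℕ) (hk : 1 ≤ k) (hn : 1 ≤ n)
    (a a' : (Fin n → ℝ) → (Fin n → ℝ)) (b b' : (Fin n → ℝ) → (Fin k → ℝ))
    (ha : ContDiff ℝ (⊤ : ℕ∞) a) (hb : ContDiff ℝ (⊤ : ℕ∞) b)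
    (ha' : ContDiff ℝ (⊤ : ℕ∞) a') (hb' : ContDiff ℝ (⊤ : ℕ∞) b') :
    lieBracketVF (HamVF a b) (HamVF a' b')
      = HamVF
          (fun y j => ∑ i, (a y i * fderiv ℝ a' y (Pi.single i 1) j
            - a' y i * fderiv ℝ a y (Pi.single i 1) j))
          (fun y p => ∑ i, (a y i * fderiv ℝ b' y (Pi.single i 1) p
            - a' y i * fderiv ℝ b y (Pi.single i 1) p)) := by
  have key {d : ℕ} (f f' : (Fin n → ℝ) → (Fin d → ℝ)) :
      (fun y p => ∑ i, (a y i * fderiv ℝ f' y (Pi.single i 1) p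
        - a' y i * fderiv ℝ f y (Pi.single i 1) p))
      = fun y => fderiv ℝ f' y (a y) - fderiv ℝ f y (a' y) := by
    ext y p
    simp [Finset.sum_sub_distrib, sum_mul_apply_single]
  rw [key, key]
  funext m
  rw [lieBracketVF, fderiv_hamVF ha hb, fderiv_hamVF ha' hb']
  ext p s
  · simp only [Prod.fst_sub, Pi.sub_apply, Finset.sum_add_distrib, sum_hamVF_fst_mul]
    simp only [HamVF, fderiv_fderiv_apply_sub ha ha' ha ha', fderiv_fderiv_apply_sub hb hb' ha ha',
      Pi.add_apply, Pi.sub_apply, mul_add, mul_sub, Finset.sum_add_distrib,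
      Finset.sum_sub_distrib]
    ring
  · rfl
end
end
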